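/- Let n ≥ 1 and let 0 < λ ≤ Λ be real numbers. Then there exist a natural number N, unit vectors γ_1, …, γ_N in ℂ^n whose collection contains an orthonormal basis of ℂ^n, and real constants 0 < C₁ ≤ C₂, such that every n×n Hermitian complex matrix A all of whose eigenvalues lie in the interval [λ, Λ] can be written as A = Σ_{ν=1}^N β_ν γ_ν γ_ν^*, where each coefficient β_ν is a real number with C₁ ≤ β_ν ≤ C₂ (here γ_ν γ_ν^* denotes the rank-one matrix with (i,j)-entry γ_{ν i} · conj(γ_{ν j})). -/

import Mathlib

open scoped BigOperators ComplexOrder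

section RankOne

open scoped NNReal
open Matrix

variable {ι : Type*} [Fintype ι]

/-- The rank-one Hermitian matrix `v v^*`. -/
def rankOne (v : EuclideanSpace ℂ ι) : Matrix ι ι ℂ :=
  vecMulVec v.ofLp (star v.ofLp)

omit [Fintype ι] in
lemma rankOne_apply (v : EuclideanSpace ℂ ι) (i j : ι) : rankOne v i j = v i * star (v j) := rfl

omit [Fintype ι] in
lemma rankOne_smul (c : ℝ) (v : EuclideanSpace ℂ ι) : rankOne (c • v) = c ^ 2 • rankOne v := by
  ext i j
  simp [rankOne_apply]
  ring

lemma posSemidef_rankOne (v : EuclideanSpace ℂ ι) : (rankOne v).PosSemidef :=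
  posSemidef_vecMulVec_self_star _

lemma star_dotProduct_self_of_norm_eq_one {v : EuclideanSpace ℂ ι} (hv : ‖v‖ = 1) :
    star v.ofLp ⬝ᵥ v.ofLp = 1 := by
  have h := inner_self_eq_norm_sq_to_K (𝕜 := ℂ) v
  rw [EuclideanSpace.inner_eq_star_dotProduct, dotProduct_comm] at h
  simpa [hv] using h

lemma trace_rankOne {v : EuclideanSpace ℂ ι} (hv : ‖v‖ = 1) : (rankOne v).trace = 1 := by
  rw [rankOne, trace_vecMulVec, dotProduct_comm, star_dotProduct_self_of_norm_eq_one hv]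

lemma norm_rankOne_sub_apply_le {v w : EuclideanSpace ℂ ι} (hv : ‖v‖ = 1) (hw : ‖w‖ = 1)
    (i j : ι) : ‖(rankOne v - rankOne w) i j‖ ≤ 2 * ‖v - w‖ := by
  have h : (rankOne v - rankOne w) i j = v i * star ((v - w) j) + (v - w) i * star (w j) := by
    simp [rankOne_apply]
    ring
  rw [h]
  have h1 := PiLp.norm_apply_le v i
  have h2 := PiLp.norm_apply_le w j
  have h3 := PiLp.norm_apply_le (v - w) i
  have h4 := PiLp.norm_apply_le (v - w) j
  refine (norm_add_le _ _).trans ?_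
  rw [norm_mul, norm_mul, norm_star, norm_star]
  rw [hv] at h1
  rw [hw] at h2
  have := mul_le_mul h1 h4 (norm_nonneg _) zero_le_one
  have := mul_le_mul h3 h2 (norm_nonneg _) (norm_nonneg _)
  linarith

omit [Fintype ι] in
lemma Matrix.PosSemidef.real_smul {M : Matrix ι ι ℂ} (hM : M.PosSemidef) {c : ℝ} (hc : 0 ≤ c) :
    (c • M).PosSemidef := by
  have := hM.smul (a := (c : ℂ)) (by simpa using hc)
  simpa using this

variable [DecidableEq ι]

lemma posSemidef_one_sub_rankOne {v : EuclideanSpace ℂ ι} (hv : ‖v‖ = 1) :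
    (1 - rankOne v).PosSemidef := by
  have hsq : rankOne v * rankOne v = rankOne v := by
    rw [rankOne, vecMulVec_mul_vecMulVec, star_dotProduct_self_of_norm_eq_one hv, one_smul]
  have h := posSemidef_conjTranspose_mul_self (1 - rankOne v)
  rw [conjTranspose_sub, conjTranspose_one, (posSemidef_rankOne v).isHermitian.eq] at h
  simpa [sub_mul, mul_sub, hsq] using h

lemma sum_rankOne_eigenvectorBasis {A : Matrix ι ι ℂ} (hA : A.IsHermitian) :
    ∑ k, rankOne (hA.eigenvectorBasis k) = 1 := by
  rw [← Unitary.coe_mul_star_self hA.eigenvectorUnitary]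
  ext i j
  simp [Matrix.sum_apply, mul_apply, rankOne_apply]

lemma sum_eigenvalues_smul_rankOne {A : Matrix ι ι ℂ} (hA : A.IsHermitian) :
    ∑ k, hA.eigenvalues k • rankOne (hA.eigenvectorBasis k) = A := by
  conv_rhs => rw [← mul_one A, ← sum_rankOne_eigenvectorBasis hA, Finset.mul_sum]
  refine Finset.sum_congr rfl fun k _ => ?_
  rw [rankOne, mul_vecMulVec, hA.mulVec_eigenvectorBasis, smul_vecMulVec]

lemma posSemidef_sub_smul_one {A : Matrix ι ι ℂ} (hA : A.IsHermitian) {c : ℝ}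
    (h : ∀ i, c ≤ hA.eigenvalues i) : (A - c • (1 : Matrix ι ι ℂ)).PosSemidef := by
  have : A - c • (1 : Matrix ι ι ℂ) =
      ∑ k, (hA.eigenvalues k - c) • rankOne (hA.eigenvectorBasis k) := by
    simp_rw [sub_smul, Finset.sum_sub_distrib, ← Finset.smul_sum,
      sum_eigenvalues_smul_rankOne, sum_rankOne_eigenvectorBasis]
  rw [this]
  exact posSemidef_sum _ fun k _ => (posSemidef_rankOne _).real_smul (sub_nonneg.2 (h k))

/-- The vectors `e_i + I ^ k • e_j` used to polarize Hermitian forms. -/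
noncomputable def polarVec (i j : ι) (k : Fin 4) : EuclideanSpace ℂ ι :=
  EuclideanSpace.single i 1 + (Complex.I ^ (k : ℕ)) • EuclideanSpace.single j 1

omit [Fintype ι] in
lemma sum_smul_rankOne_polarVec (i j : ι) (z : ℂ) (η : ℝ) :
    ∑ k : Fin 4, (((Complex.I ^ (k : ℕ) * z).re + η) / 4) • rankOne (polarVec i j k) =
      (1 / 2 : ℂ) • (Matrix.single i j z + Matrix.single j i (star z)) +
        η • (Matrix.single i i 1 + Matrix.single j j 1) := by
  have key : ∀ a b c d : ℂ, ∑ k : Fin 4, ((((Complex.I ^ (k : ℕ) * z).re + η) / 4 : ℝ) : ℂ) *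
      ((a + Complex.I ^ (k : ℕ) * b) * (c + star (Complex.I ^ (k : ℕ)) * d)) =
      (1 / 2) * (z * (a * d) + star z * (b * c)) + η * (a * c + b * d) := by
    intro a b c d
    obtain ⟨x, y⟩ := z
    have hz : star (⟨x, y⟩ : ℂ) = x - y * Complex.I := by
      apply Complex.ext <;> simp
    have h3 : Complex.I ^ 3 = -Complex.I := by rw [pow_succ, Complex.I_sq]; ring
    rw [hz, Complex.mk_eq_add_mul_I]
    simp [Fin.sum_univ_four, h3]
    linear_combination (-(b * d * (η : ℂ)) / 2 - (η + y) *
      (a * d * Complex.I - b * d * Complex.I ^ 2) / 4) * Complex.I_sq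
  ext p q
  refine Eq.trans ?_ ((key (if i = p then 1 else 0) (if j = p then 1 else 0)
    (if i = q then 1 else 0) (if j = q then 1 else 0)).trans ?_)
  · rw [Matrix.sum_apply]
    refine Finset.sum_congr rfl fun k _ => ?_
    simp only [Matrix.smul_apply, Complex.real_smul, rankOne_apply, polarVec, PiLp.add_apply,
      PiLp.smul_apply, PiLp.single_apply, smul_eq_mul, star_add, star_mul', @eq_comm _ p,
      @eq_comm _ q]
    split_ifs <;> simp
  · simp only [Matrix.add_apply, Matrix.smul_apply, Complex.real_smul, Matrix.single_apply,
      smul_eq_mul, ite_and]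
    split_ifs <;> simp

/-- Hermitian matrices with small entries become nonnegative combinations of the polarization
vectors after adding a multiple of the identity. -/
lemma add_smul_one_eq_sum_polarVec {E : Matrix ι ι ℂ} (hE : E.IsHermitian) (η : ℝ) :
    E + (2 * Fintype.card ι * η) • (1 : Matrix ι ι ℂ) =
      ∑ i, ∑ j, ∑ k : Fin 4,
        (((Complex.I ^ (k : ℕ) * E i j).re + η) / 4) • rankOne (polarVec i j k) := by
  simp_rw [sum_smul_rankOne_polarVec]
  have h1 : ∑ i, ∑ j, Matrix.single i j (E i j) = E := (matrix_eq_sum_single E).symm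
  have h2 : ∑ i, ∑ j, Matrix.single j i (star (E i j)) = E := by
    rw [Finset.sum_comm]
    simp_rw [hE.apply]
    exact h1
  have h3 : ∑ i : ι, Matrix.single i i (1 : ℂ) = 1 := by
    rw [← diagonal_one, ← sum_single_eq_diagonal]
  simp only [Finset.sum_add_distrib, ← Finset.smul_sum, h1, h2, h3, Finset.sum_const,
    Finset.card_univ, ← Nat.cast_smul_eq_nsmul ℝ]
  ext p q
  simp
  ring

omit [Fintype ι] [DecidableEq ι] in
lemma real_smul_mem {C : Submodule ℝ≥0 (Matrix ι ι ℂ)} {M : Matrix ι ι ℂ} (hM : M ∈ C)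
    {c : ℝ} (hc : 0 ≤ c) : c • M ∈ C :=
  C.smul_mem ⟨c, hc⟩ hM

omit [DecidableEq ι] in
lemma rankOne_mem_of_normalize_mem {C : Submodule ℝ≥0 (Matrix ι ι ℂ)} {u : EuclideanSpace ℂ ι}
    (h : u ≠ 0 → rankOne (‖u‖⁻¹ • u) ∈ C) : rankOne u ∈ C := by
  by_cases hu : u = 0
  · have : rankOne u = 0 := by
      ext i j
      simp [rankOne_apply, hu]
    simp [this]
  · have h1 : ‖u‖ • ‖u‖⁻¹ • u = u := smul_inv_smul₀ (norm_ne_zero_iff.2 hu) u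
    rw [← h1, rankOne_smul]
    exact real_smul_mem (h hu) (sq_nonneg _)

lemma eigenvalues_le_trace {M : Matrix ι ι ℂ} (hM : M.PosSemidef) :
    ∑ k, hM.isHermitian.eigenvalues k = M.trace.re := by
  simp [hM.isHermitian.trace_eq_sum_eigenvalues]

/-- Finitely many unit vectors generate a cone that contains every positive semidefinite matrix
of bounded trace, shifted by a fixed positive multiple of the identity. -/
lemma exists_finset_add_smul_one_mem_span [Nonempty ι] {t τ : ℝ} (ht : 0 < t) (hτ : 0 < τ) :
    ∃ G : Finset (EuclideanSpace ℂ ι), (∀ v ∈ G, ‖v‖ = 1) ∧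
      (∀ i, EuclideanSpace.single i 1 ∈ G) ∧
      ∀ M : Matrix ι ι ℂ, M.PosSemidef → M.trace.re ≤ τ →
        M + t • (1 : Matrix ι ι ℂ) ∈ Submodule.span ℝ≥0 (rankOne '' (G : Set _)) := by
  classical
  set η : ℝ := t / (2 * Fintype.card ι) with hη
  have hcard : (0 : ℝ) < Fintype.card ι := by exact_mod_cast Fintype.card_pos
  have hη0 : 0 < η := by positivity
  obtain ⟨T, hT1, hTfin, hTcov⟩ := (isCompact_sphere (0 : EuclideanSpace ℂ ι) 1).finite_cover_balls
    (show 0 < η / (2 * τ) by positivity)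
  let F : Finset (EuclideanSpace ℂ ι) :=
    (Finset.univ.image fun x : ι × ι × Fin 4 =>
      ‖polarVec x.1 x.2.1 x.2.2‖⁻¹ • polarVec x.1 x.2.1 x.2.2).filter fun v => ‖v‖ = 1
  let G : Finset (EuclideanSpace ℂ ι) :=
    (hTfin.toFinset ∪ F) ∪ Finset.univ.image fun i => EuclideanSpace.single i 1
  refine ⟨G, ?_, fun i => by simp [G], fun M hM hMτ => ?_⟩
  · intro v hv
    simp only [G, F, Finset.mem_union, Set.Finite.mem_toFinset, Finset.mem_filter,
      Finset.mem_image, Finset.mem_univ, true_and] at hv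
    rcases hv with (hv | hv) | ⟨i, rfl⟩
    · simpa using hT1 hv
    · exact hv.2
    · simp
  set C := Submodule.span ℝ≥0 (rankOne '' (G : Set (EuclideanSpace ℂ ι)))
  have hG : ∀ v ∈ G, rankOne v ∈ C := fun v hv => Submodule.subset_span ⟨v, hv, rfl⟩
  set b := hM.isHermitian.eigenvectorBasis
  set μ := hM.isHermitian.eigenvalues
  have hμ : ∀ k, 0 ≤ μ k := hM.eigenvalues_nonneg
  have hb : ∀ k, ‖b k‖ = 1 := b.orthonormal.1
  have hw : ∀ k, ∃ w ∈ T, ‖b k - w‖ < η / (2 * τ) := by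
    intro k
    have := hTcov (show b k ∈ Metric.sphere 0 1 by simp [hb k])
    simpa [dist_eq_norm] using this
  choose w hwT hwb using hw
  have hw1 : ∀ k, ‖w k‖ = 1 := fun k => by simpa using hT1 (hwT k)
  set B : Matrix ι ι ℂ := ∑ k, μ k • rankOne (w k)
  have hBC : B ∈ C := Submodule.sum_mem _ fun k _ =>
    real_smul_mem (hG _ (by simp [G, hwT k])) (hμ k)
  have hBpos : B.PosSemidef := posSemidef_sum _ fun k _ =>
    (posSemidef_rankOne _).real_smul (hμ k)
  have hE : M - B = ∑ k, μ k • (rankOne (b k) - rankOne (w k)) := by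
    simp_rw [smul_sub, Finset.sum_sub_distrib]
    rw [sum_eigenvalues_smul_rankOne hM.isHermitian]
  have hEη : ∀ i j, ‖(M - B) i j‖ ≤ η := by
    intro i j
    calc ‖(M - B) i j‖ ≤ ∑ k, μ k * (2 * (η / (2 * τ))) := by
          rw [hE, Matrix.sum_apply]
          refine norm_sum_le_of_le _ fun k _ => ?_
          rw [Matrix.smul_apply, norm_smul, Real.norm_of_nonneg (hμ k)]
          exact mul_le_mul_of_nonneg_left ((norm_rankOne_sub_apply_le (hb k) (hw1 k) i j).trans
            (by linarith [hwb k])) (hμ k)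
      _ = M.trace.re * (2 * (η / (2 * τ))) := by
          rw [← Finset.sum_mul, eigenvalues_le_trace hM]
      _ ≤ τ * (2 * (η / (2 * τ))) := by gcongr
      _ = η := by field_simp
  have hEC : (M - B) + t • (1 : Matrix ι ι ℂ) ∈ C := by
    have hc : t = 2 * Fintype.card ι * η := by rw [hη]; field_simp
    rw [hc, add_smul_one_eq_sum_polarVec (hM.isHermitian.sub hBpos.isHermitian)]
    refine Submodule.sum_mem _ fun i _ => Submodule.sum_mem _ fun j _ =>
      Submodule.sum_mem _ fun k _ => real_smul_mem (rankOne_mem_of_normalize_mem fun hu => ?_) ?_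
    · refine hG _ (Finset.mem_union_left _ (Finset.mem_union_right _ (Finset.mem_filter.2
        ⟨Finset.mem_image.2 ⟨(i, j, k), Finset.mem_univ _, rfl⟩, ?_⟩)))
      exact norm_smul_inv_norm (𝕜 := ℝ) hu
    · have h1 := (Complex.abs_re_le_norm (Complex.I ^ (k : ℕ) * (M - B) i j))
      rw [norm_mul, norm_pow, Complex.norm_I, one_pow, one_mul] at h1
      have h2 := neg_le_of_abs_le (h1.trans (hEη i j))
      linarith
  have := C.add_mem hBC hEC
  rwa [← add_assoc, add_sub_cancel] at this

end RankOne

/-- Linear–algebra lemma behind the Evans–Krylov estimate: for `n ≥ 1` and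
`0 < λ ≤ Λ` there are finitely many unit vectors `γ₁, …, γ_N` in `ℂⁿ` containing an
orthonormal basis, and constants `0 < C₁ ≤ C₂`, such that every Hermitian `n×n` matrix
with eigenvalues in `[λ, Λ]` is `Σ_ν β_ν γ_ν γ_ν^*` with `C₁ ≤ β_ν ≤ C₂`. -/
theorem stmt_0 (n : ℕ) (hn : 1 ≤ n) (lam Lam : ℝ) (hlam : 0 < lam) (hle : lam ≤ Lam) :
    ∃ (N : ℕ) (γ : Fin N → EuclideanSpace ℂ (Fin n)) (C₁ C₂ : ℝ),
      (∀ ν, ‖γ ν‖ = 1) ∧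
      (∃ b : OrthonormalBasis (Fin n) ℂ (EuclideanSpace ℂ (Fin n)),
        ∀ i, ∃ ν, γ ν = b i) ∧
      0 < C₁ ∧ C₁ ≤ C₂ ∧
      ∀ (A : Matrix (Fin n) (Fin n) ℂ) (hA : A.IsHermitian),
        (∀ i, hA.eigenvalues i ∈ Set.Icc lam Lam) →
        ∃ β : Fin N → ℝ,
          (∀ ν, C₁ ≤ β ν ∧ β ν ≤ C₂) ∧
          A = ∑ ν, (β ν : ℂ) •
            Matrix.vecMulVec (fun i => γ ν i) (fun j => (starRingEnd ℂ) (γ ν j)) := by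
  classical
  have : Nonempty (Fin n) := ⟨⟨0, hn⟩⟩
  have hn0 : (0 : ℝ) < n := by exact_mod_cast hn
  have hLam : 0 < Lam := hlam.trans_le hle
  obtain ⟨G, hG1, hGe, hG⟩ := exists_finset_add_smul_one_mem_span (ι := Fin n)
    (half_pos hlam) (mul_pos hn0 hLam)
  have hGcard : (0 : ℝ) < G.card := by
    exact_mod_cast Finset.card_pos.2 ⟨_, hGe ⟨0, hn⟩⟩
  set δ : ℝ := lam / (2 * G.card) with hδ
  have hδ0 : 0 < δ := by positivity
  let e := G.equivFin.symm
  have hsum : ∀ f : EuclideanSpace ℂ (Fin n) → Matrix (Fin n) (Fin n) ℂ,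
      ∑ ν, f (e ν) = ∑ v ∈ G, f v := fun f => by
    rw [e.sum_comp fun v : G => f v, Finset.sum_coe_sort]
  refine ⟨G.card, fun ν => e ν, δ, δ + n * Lam, fun ν => hG1 _ (e ν).2,
    ⟨EuclideanSpace.basisFun _ ℂ, fun i => ⟨e.symm ⟨_, hGe i⟩, by simp⟩⟩, hδ0,
    by linarith [mul_pos hn0 hLam], fun A hA hspec => ?_⟩
  set M : Matrix (Fin n) (Fin n) ℂ :=
    A - (lam / 2) • (1 : Matrix (Fin n) (Fin n) ℂ) - δ • ∑ v ∈ G, rankOne v with hMdef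
  have hM : M.PosSemidef := by
    have h1 : M = (A - lam • (1 : Matrix (Fin n) (Fin n) ℂ)) + δ • ∑ v ∈ G, (1 - rankOne v) := by
      have h2 : lam = lam / 2 + δ * G.card := by
        rw [hδ]
        field_simp
        norm_num
      rw [Finset.sum_sub_distrib, Finset.sum_const, ← Nat.cast_smul_eq_nsmul ℝ, smul_sub,
        smul_smul, hMdef]
      have h3 : lam • (1 : Matrix (Fin n) (Fin n) ℂ) =
          (lam / 2) • 1 + (δ * G.card) • 1 := by rw [← add_smul, ← h2]
      rw [h3]
      abel
    rw [h1]
    exact (posSemidef_sub_smul_one hA fun i => (hspec i).1).add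
      ((Matrix.posSemidef_sum _ fun v hv => posSemidef_one_sub_rankOne (hG1 v hv)).real_smul hδ0.le)
  have hAtr : A.trace.re ≤ n * Lam := by
    rw [hA.trace_eq_sum_eigenvalues]
    simpa using Finset.sum_le_sum fun i (_ : i ∈ Finset.univ) => (hspec i).2
  have htrG : (∑ v ∈ G, rankOne v).trace = G.card := by
    rw [Matrix.trace_sum, Finset.sum_congr rfl fun v hv => trace_rankOne (hG1 v hv)]
    simp
  have hMtr : M.trace.re ≤ n * Lam := by
    have : M.trace.re = A.trace.re - lam / 2 * n - δ * G.card := by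
      simp [hMdef, htrG, Matrix.trace_sub, Matrix.trace_smul]
    rw [this]
    have := mul_pos (half_pos hlam) hn0
    have := mul_pos hδ0 hGcard
    linarith
  obtain ⟨c, hc⟩ := (Submodule.mem_span_image_finset_iff_exists_fun' NNReal).1 (hG M hM hMtr)
  have hAsum : A = ∑ v ∈ G, ((c v : ℝ) + δ) • rankOne v := by
    simp_rw [add_smul, Finset.sum_add_distrib, ← Finset.smul_sum]
    have : ∑ v ∈ G, (c v : ℝ) • rankOne v = M + (lam / 2) • 1 := hc
    rw [this, hMdef]
    abel
  have htr : ∑ v ∈ G, ((c v : ℝ) + δ) = A.trace.re := by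
    rw [hAsum, Matrix.trace_sum, Complex.re_sum]
    refine Finset.sum_congr rfl fun v hv => ?_
    simp [Matrix.trace_smul, trace_rankOne (hG1 v hv)]
  refine ⟨fun ν => (c (e ν) : ℝ) + δ, fun ν => ⟨by simp, ?_⟩, ?_⟩
  · have := Finset.single_le_sum (f := fun v => (c v : ℝ) + δ)
      (fun v _ => by positivity) (e ν).2
    linarith
  · conv_lhs => rw [hAsum, ← hsum]
    refine Finset.sum_congr rfl fun ν _ => ?_
    rw [Complex.coe_smul]
    rfl
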